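/- arXiv:1410.2818 — 7 statements merged into one kernel-verified Lean document; each statement's English description precedes it below -/
import Mathlib

section
/- For every invertible real 3×3 matrix F and every symmetric real 3×3 matrix S, the Frobenius norm satisfies ‖Fᵀ S F⁻ᵀ‖² ≥ (1/2)‖S‖². -/
open Matrix

noncomputable section

/-- 3×3 real matrices. -/
abbrev M3 := Matrix (Fin 3) (Fin 3) ℝ

/-- Squared Frobenius norm: ‖X‖² = tr(X Xᵀ). -/
def frobNormSq (X : M3) : ℝ := (X * Xᵀ).trace

/-- The trace of `X²` is at most the squared Frobenius norm of `X`. -/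
theorem trace_mul_self_le_frobNormSq (X : M3) : (X * X).trace ≤ frobNormSq X := by
  simp only [frobNormSq, Matrix.trace, Matrix.diag, Matrix.mul_apply, Matrix.transpose_apply,
    Fin.sum_univ_three]
  linarith [sq_nonneg (X 0 1 - X 1 0), sq_nonneg (X 0 2 - X 2 0), sq_nonneg (X 1 2 - X 2 1)]

theorem frobNormSq_nonneg (X : M3) : 0 ≤ frobNormSq X := by
  simp only [frobNormSq, Matrix.trace, Matrix.diag, Matrix.mul_apply, Matrix.transpose_apply]
  exact Finset.sum_nonneg fun i _ => Finset.sum_nonneg fun j _ => mul_self_nonneg _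

/-- For every invertible real 3×3 matrix `F` and every symmetric real 3×3 matrix `S`,
the Frobenius norm satisfies ‖Fᵀ S F⁻ᵀ‖² ≥ (1/2) ‖S‖². -/
theorem stmt0 (F S : M3) (hF : IsUnit F.det) (hS : S = Sᵀ) :
    frobNormSq (Fᵀ * S * (F⁻¹)ᵀ) ≥ (1 / 2 : ℝ) * frobNormSq S := by
  have hinv : (F⁻¹)ᵀ * Fᵀ = 1 := by
    rw [← Matrix.transpose_mul, Matrix.mul_nonsing_inv F hF, Matrix.transpose_one]
  have htrace : ((Fᵀ * S * (F⁻¹)ᵀ) * (Fᵀ * S * (F⁻¹)ᵀ)).trace = frobNormSq S := by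
    calc ((Fᵀ * S * (F⁻¹)ᵀ) * (Fᵀ * S * (F⁻¹)ᵀ)).trace
        = (Fᵀ * (S * ((F⁻¹)ᵀ * Fᵀ) * S * (F⁻¹)ᵀ)).trace := by simp only [Matrix.mul_assoc]
      _ = (S * S * ((F⁻¹)ᵀ * Fᵀ)).trace := by
        rw [hinv, Matrix.mul_one, Matrix.trace_mul_comm, Matrix.mul_assoc, hinv, Matrix.mul_one]
      _ = frobNormSq S := by rw [hinv, Matrix.mul_one, frobNormSq, ← hS]
  linarith [trace_mul_self_le_frobNormSq (Fᵀ * S * (F⁻¹)ᵀ), frobNormSq_nonneg S]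
end
end

section
/- For every invertible real 3×3 matrix F and every symmetric real 3×3 matrix τ, one has ‖dev₃(Fᵀ τ F⁻ᵀ)‖ ≥ (1/√2)‖dev₃ τ‖, where the key intermediate identities are dev₃(Fᵀ τ F⁻ᵀ) = Fᵀ (dev₃ τ) F⁻ᵀ and tr(Fᵀ τ F⁻ᵀ) = tr(τ). -/
open Matrix

noncomputable section

/-- Frobenius norm: ‖X‖ = √tr(X Xᵀ). -/
def frobNorm (X : M3) : ℝ := Real.sqrt ((X * Xᵀ).trace)

/-- Deviatoric part: dev₃ X = X − (1/3) tr(X) 𝟙. -/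
def dev3 (X : M3) : M3 := X - (X.trace / 3) • (1 : M3)

theorem trace_sq_le_trace_mul_transpose {n : Type*} [Fintype n] (X : Matrix n n ℝ) :
    (X * X).trace ≤ (X * Xᵀ).trace := by
  have h : 0 ≤ ((X - Xᵀ) * (X - Xᵀ)ᵀ).trace := by
    simp only [trace, diag_apply, mul_apply, transpose_apply]
    exact Finset.sum_nonneg fun i _ => Finset.sum_nonneg fun j _ => mul_self_nonneg _
  have h₁ : (Xᵀ * Xᵀ).trace = (X * X).trace := by rw [← transpose_mul, trace_transpose]
  have h₂ : (Xᵀ * X).trace = (X * Xᵀ).trace := trace_mul_comm _ _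
  simp only [transpose_sub, transpose_transpose, sub_mul, mul_sub, trace_sub, h₁, h₂] at h
  linarith

/-- For symmetric `A`, the Frobenius norm is minimal in its similarity class. -/
theorem frobNorm_le_frobNorm_conj {A P Q : M3} (hA : Aᵀ = A) (hQP : Q * P = 1) :
    frobNorm A ≤ frobNorm (P * A * Q) := by
  refine Real.sqrt_le_sqrt (le_trans (le_of_eq ?_) (trace_sq_le_trace_mul_transpose _))
  calc (A * Aᵀ).trace = (Q * P * (A * (Q * P) * A)).trace := by simp [hA, hQP]
    _ = (Q * (P * A * Q * (P * A))).trace := by simp only [Matrix.mul_assoc]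
    _ = (P * A * Q * (P * A * Q)).trace := by
      rw [trace_mul_comm]; simp only [Matrix.mul_assoc]

theorem dev3_transpose (X : M3) : (dev3 X)ᵀ = dev3 Xᵀ := by
  simp [dev3]

theorem trace_conj {P Q : M3} (hQP : Q * P = 1) (X : M3) : (P * X * Q).trace = X.trace := by
  rw [trace_mul_comm, ← Matrix.mul_assoc, hQP, Matrix.one_mul]

theorem dev3_conj {P Q : M3} (hQP : Q * P = 1) (X : M3) :
    dev3 (P * X * Q) = P * dev3 X * Q := by
  simp [dev3, trace_conj hQP, mul_sub, sub_mul, mul_eq_one_comm.mp hQP]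

/-- For every invertible real 3×3 matrix `F` and every symmetric 3×3 matrix `τ`,
one has ‖dev₃(Fᵀ τ F⁻ᵀ)‖ ≥ (1/√2) ‖dev₃ τ‖, with the key intermediate identities
dev₃(Fᵀ τ F⁻ᵀ) = Fᵀ (dev₃ τ) F⁻ᵀ and tr(Fᵀ τ F⁻ᵀ) = tr(τ). -/
theorem stmt1 (F τ : M3) (hF : IsUnit F.det) (hτ : τ = τᵀ) :
    frobNorm (dev3 (Fᵀ * τ * (F⁻¹)ᵀ)) ≥ (1 / Real.sqrt 2) * frobNorm (dev3 τ) ∧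
    dev3 (Fᵀ * τ * (F⁻¹)ᵀ) = Fᵀ * (dev3 τ) * (F⁻¹)ᵀ ∧
    (Fᵀ * τ * (F⁻¹)ᵀ).trace = τ.trace := by
  have hQP : (F⁻¹)ᵀ * Fᵀ = 1 := by
    rw [← transpose_mul, mul_nonsing_inv F hF, transpose_one]
  refine ⟨?_, dev3_conj hQP τ, trace_conj hQP τ⟩
  rw [dev3_conj hQP]
  have hA : (dev3 τ)ᵀ = dev3 τ := by rw [dev3_transpose, ← hτ]
  have hc : 1 / Real.sqrt 2 ≤ 1 :=
    div_le_one_of_le₀ (Real.one_le_sqrt.mpr one_le_two) (Real.sqrt_nonneg 2)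
  exact (mul_le_of_le_one_left (Real.sqrt_nonneg _) hc).trans (frobNorm_le_frobNorm_conj hA hQP)
end
end

section
/- Let F_e be an invertible real 3×3 matrix, B_e = F_e F_eᵀ, and let τ_e be a symmetric real 3×3 matrix that commutes with B_e (i.e. τ_e B_e = B_e τ_e). Set Σ_e = F_eᵀ τ_e F_e⁻ᵀ. Then ‖dev₃ Σ_e‖ = ‖dev₃ τ_e‖. -/
open Matrix

noncomputable section

theorem frobNorm_transpose_mul_mul_inv_transpose {F D : M3} (hF : IsUnit F.det) (hD : Dᵀ = D)
    (hcomm : D * (F * Fᵀ) = (F * Fᵀ) * D) : frobNorm (Fᵀ * D * (F⁻¹)ᵀ) = frobNorm D := by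
  have hFt : IsUnit Fᵀ.det := by rwa [det_transpose]
  unfold frobNorm
  congr 1
  calc (Fᵀ * D * (F⁻¹)ᵀ * (Fᵀ * D * (F⁻¹)ᵀ)ᵀ).trace
      = (Fᵀ * (D * (Fᵀ⁻¹ * (F⁻¹ * (D * F))))).trace := by
        simp only [transpose_mul, transpose_transpose, transpose_nonsing_inv, hD, Matrix.mul_assoc]
    _ = (D * (Fᵀ⁻¹ * (F⁻¹ * (D * (F * Fᵀ))))).trace := by
        rw [trace_mul_comm]
        simp only [Matrix.mul_assoc]
    _ = (D * Dᵀ).trace := by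
        rw [hcomm, Matrix.mul_assoc, nonsing_inv_mul_cancel_left _ _ hF,
          nonsing_inv_mul_cancel_left _ _ hFt, hD]

theorem dev3_transpose_mul_mul_inv_transpose {F : M3} (hF : IsUnit F.det) (X : M3) :
    dev3 (Fᵀ * X * (F⁻¹)ᵀ) = Fᵀ * dev3 X * (F⁻¹)ᵀ := by
  have hFt : IsUnit Fᵀ.det := by rwa [det_transpose]
  have htr : (Fᵀ * X * (F⁻¹)ᵀ).trace = X.trace := by
    rw [trace_mul_comm, transpose_nonsing_inv, nonsing_inv_mul_cancel_left _ _ hFt]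
  rw [dev3, dev3, htr, Matrix.mul_sub, Matrix.sub_mul, Matrix.mul_smul, Matrix.smul_mul,
    Matrix.mul_one, transpose_nonsing_inv, mul_nonsing_inv _ hFt]

/-- Let `Fe` be invertible, `Be = Fe Feᵀ`, and `τe` symmetric, commuting with `Be`.
With `Σe = Feᵀ τe Fe⁻ᵀ` one has ‖dev₃ Σe‖ = ‖dev₃ τe‖ (isotropic case). -/
theorem stmt2 (Fe τe : M3) (hFe : IsUnit Fe.det) (hτ : τe = τeᵀ)
    (hcomm : τe * (Fe * Feᵀ) = (Fe * Feᵀ) * τe) :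
    frobNorm (dev3 (Feᵀ * τe * (Fe⁻¹)ᵀ)) = frobNorm (dev3 τe) := by
  rw [dev3_transpose_mul_mul_inv_transpose hFe]
  apply frobNorm_transpose_mul_mul_inv_transpose hFe
  · simp [dev3, ← hτ]
  · simp only [dev3, Matrix.sub_mul, Matrix.mul_sub, hcomm, Matrix.smul_mul, Matrix.mul_smul,
      Matrix.one_mul, Matrix.mul_one]
end
end

section
/- Let t ↦ C_p(t) be a continuous map from [0,∞) into the real 3×3 matrices such that det C_p(t) = 1 for all t > 0, C_p(t) is symmetric for all t > 0, and C_p(0) is symmetric positive definite. Then C_p(t) is symmetric positive definite for all t > 0. -/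
open Matrix

noncomputable section

section

variable {n : Type*} [Fintype n]

/-- Strict positivity of the quadratic form on the unit sphere is an open condition, because the
sphere is compact. -/
theorem isOpen_setOf_forall_sphere_dotProduct_mulVec_pos :
    IsOpen {A : Matrix n n ℝ | ∀ x ∈ Metric.sphere (0 : n → ℝ) 1, 0 < x ⬝ᵥ (A *ᵥ x)} := by
  refine isOpen_iff_eventually.2 fun A hA =>
    (isCompact_sphere _ _).eventually_forall_of_forall_eventually fun x hx => ?_
  have hc : Continuous fun p : Matrix n n ℝ × (n → ℝ) => p.2 ⬝ᵥ (p.1 *ᵥ p.2) := by fun_prop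
  exact (hc.tendsto (A, x)).eventually_const_lt (hA x hx)

theorem Matrix.IsHermitian.posDef_iff_forall_sphere {A : Matrix n n ℝ} (hA : A.IsHermitian) :
    A.PosDef ↔ ∀ x ∈ Metric.sphere (0 : n → ℝ) 1, 0 < x ⬝ᵥ (A *ᵥ x) := by
  refine ⟨fun h x hx => by
    simpa using h.dotProduct_mulVec_pos (ne_zero_of_mem_unit_sphere (⟨x, hx⟩ : Metric.sphere _ 1)),
    fun h => .of_dotProduct_mulVec_pos hA fun x hx => ?_⟩
  have hx' : 0 < ‖x‖⁻¹ := inv_pos.2 (norm_pos_iff.2 hx)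
  have hs := h (‖x‖⁻¹ • x) (by simp [norm_smul, hx])
  rw [mulVec_smul, smul_dotProduct, dotProduct_smul, smul_eq_mul, smul_eq_mul] at hs
  simpa using (mul_pos_iff_of_pos_left hx').1 ((mul_pos_iff_of_pos_left hx').1 hs)

theorem isClosed_setOf_posSemidef : IsClosed {A : Matrix n n ℝ | A.PosSemidef} := by
  simp only [posSemidef_iff_dotProduct_mulVec, IsHermitian, Set.ofPred_and, Set.ofPred_forall]
  exact (isClosed_eq (by fun_prop) continuous_id).inter
    (isClosed_iInter fun x => isClosed_le continuous_const (by fun_prop))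

/-- A preconnected set of invertible symmetric matrices containing a positive definite matrix
consists of positive definite matrices. -/
theorem IsPreconnected.posDef_of_det_ne_zero [DecidableEq n] {S : Set (Matrix n n ℝ)}
    (hS : IsPreconnected S) (hherm : ∀ A ∈ S, A.IsHermitian) (hdet : ∀ A ∈ S, A.det ≠ 0)
    {A B : Matrix n n ℝ} (hA : A ∈ S) (hpos : A.PosDef) (hB : B ∈ S) : B.PosDef := by
  have : PreconnectedSpace S := Subtype.preconnectedSpace hS
  have hopen : IsOpen {M : S | M.1.PosDef} := by
    simp only [fun M : S => (hherm M M.2).posDef_iff_forall_sphere]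
    exact isOpen_setOf_forall_sphere_dotProduct_mulVec_pos.preimage continuous_subtype_val
  have hclosed : IsClosed {M : S | M.1.PosDef} := by
    have : {M : S | M.1.PosDef} = {M : S | M.1.PosSemidef} := by
      ext M
      exact ⟨fun h => h.posSemidef, fun h => h.posDef_iff_det_ne_zero.2 (hdet M M.2)⟩
    rw [this]
    exact isClosed_setOf_posSemidef.preimage continuous_subtype_val
  have huniv := IsClopen.eq_univ ⟨hclosed, hopen⟩ ⟨⟨A, hA⟩, hpos⟩
  exact huniv.ge (Set.mem_univ (⟨B, hB⟩ : S))

end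

/-- If `t ↦ Cp t` is a continuous map on `[0,∞)`, `det (Cp t) = 1` and `Cp t` is symmetric
for all `t > 0`, and `Cp 0` is symmetric positive definite, then `Cp t` is symmetric
positive definite for all `t > 0`. -/
theorem stmt5 (Cp : ℝ → M3) (hcont : ContinuousOn Cp (Set.Ici (0 : ℝ)))
    (hdet : ∀ t : ℝ, 0 < t → (Cp t).det = 1)
    (hsym : ∀ t : ℝ, 0 < t → Cp t = (Cp t)ᵀ)
    (h0 : (Cp 0).PosDef) :
    ∀ t : ℝ, 0 < t → (Cp t).PosDef := by
  intro t ht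
  refine (isPreconnected_Ici.image Cp hcont).posDef_of_det_ne_zero ?_ ?_
    (Set.mem_image_of_mem Cp Set.self_mem_Ici) h0 (Set.mem_image_of_mem Cp ht.le)
  · rintro _ ⟨s, hs, rfl⟩
    rcases (Set.mem_Ici.1 hs).eq_or_lt with rfl | hs
    · exact h0.isHermitian
    · rw [IsHermitian, conjTranspose_eq_transpose_of_trivial, ← hsym s hs]
  · rintro _ ⟨s, hs, rfl⟩
    rcases (Set.mem_Ici.1 hs).eq_or_lt with rfl | hs
    · exact h0.det_pos.ne'
    · simp [hdet s hs]
end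
end

section
/- Let F_p be an invertible real 3×3 matrix, C a symmetric real 3×3 matrix, C_p = F_pᵀ F_p, and C_e = F_p⁻ᵀ C F_p⁻¹. For real scalars α₁, α₂, α₃ define Σ_e := 2 C_e (α₁ 𝟙 + α₂ C_e + α₃ C_e²) and f̂ := α₁ C + α₂ C C_p⁻¹ C + α₃ C C_p⁻¹ C C_p⁻¹ C. Then F_p⁻¹ Σ_e F_p⁻ᵀ = 2 C_p⁻¹ f̂ C_p⁻¹, f̂ is symmetric, and tr(Σ_e) = 2 tr(f̂ C_p⁻¹). -/
open Matrix

noncomputable section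

/-- Representation formula for the isotropic case: with `Cp = Fpᵀ Fp`,
`Ce = Fp⁻ᵀ C Fp⁻¹`, `Se = 2 Ce (α₁ 𝟙 + α₂ Ce + α₃ Ce²)` (the Mandel stress Σ_e) and
`f̂ = α₁ C + α₂ C Cp⁻¹ C + α₃ C Cp⁻¹ C Cp⁻¹ C`, one has
`Fp⁻¹ Se Fp⁻ᵀ = 2 Cp⁻¹ f̂ Cp⁻¹`, `f̂` symmetric, and `tr Se = 2 tr(f̂ Cp⁻¹)`. -/
theorem stmt10 (Fp C : M3) (hFp : IsUnit Fp.det) (hC : C = Cᵀ) (α₁ α₂ α₃ : ℝ)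
    (Cp Ce Se fhat : M3)
    (hCp : Cp = Fpᵀ * Fp)
    (hCe : Ce = (Fp⁻¹)ᵀ * C * Fp⁻¹)
    (hSe : Se = (2 : ℝ) • (Ce * (α₁ • (1 : M3) + α₂ • Ce + α₃ • (Ce * Ce))))
    (hf : fhat = α₁ • C + α₂ • (C * Cp⁻¹ * C) + α₃ • (C * Cp⁻¹ * C * Cp⁻¹ * C)) :
    Fp⁻¹ * Se * (Fp⁻¹)ᵀ = (2 : ℝ) • (Cp⁻¹ * fhat * Cp⁻¹) ∧
    fhat = fhatᵀ ∧
    Se.trace = 2 * (fhat * Cp⁻¹).trace := by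
  have hCpi : Cp⁻¹ = Fp⁻¹ * (Fp⁻¹)ᵀ := by
    rw [hCp, Matrix.mul_inv_rev, Matrix.transpose_nonsing_inv]
  have hSef : Se = (2 : ℝ) • ((Fp⁻¹)ᵀ * fhat * Fp⁻¹) := by
    rw [hSe, hf, hCe, hCpi]
    simp only [mul_add, add_mul, Matrix.mul_smul, Matrix.smul_mul, mul_one, mul_assoc]
  refine ⟨?_, ?_, ?_⟩
  · rw [hSef, hCpi]
    simp only [Matrix.mul_smul, Matrix.smul_mul, mul_assoc]
  · rw [hf, hCpi]
    simp only [Matrix.transpose_add, Matrix.transpose_smul, Matrix.transpose_mul,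
      Matrix.transpose_transpose, ← hC, mul_assoc]
  · rw [hSef, hCpi, Matrix.trace_smul, smul_eq_mul, mul_assoc, Matrix.trace_mul_comm, mul_assoc]
end
end

section
/- Let F_p be an invertible real 3×3 matrix, C a symmetric real 3×3 matrix, and C_p = F_pᵀ F_p. Then ‖dev₃(F_p⁻ᵀ C F_p⁻¹)‖² = tr[(C_p⁻¹ C)²] − (1/3)[tr(C_p⁻¹ C)]². -/
open Matrix

noncomputable section

/-- The squared norm of the deviator of a symmetric matrix, by its first two power traces. -/
lemma frobNormSq_dev3_of_isSymm {X : M3} (hX : X.IsSymm) :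
    frobNormSq (dev3 X) = (X * X).trace - (1 / 3 : ℝ) * X.trace ^ 2 := by
  simp only [frobNormSq, dev3, transpose_sub, transpose_smul, transpose_one, hX.eq, sub_mul,
    mul_sub, smul_mul_assoc, mul_smul_comm, one_mul, mul_one, trace_sub, trace_smul, smul_eq_mul,
    trace_one, Fintype.card_fin, Nat.cast_ofNat]
  ring

/-- Let `Fp` be invertible, `C` symmetric, `Cp = Fpᵀ Fp`. Then
‖dev₃(Fp⁻ᵀ C Fp⁻¹)‖² = tr[(Cp⁻¹ C)²] − (1/3)[tr(Cp⁻¹ C)]². -/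
theorem stmt11 (Fp C : M3) (hFp : IsUnit Fp.det) (hC : C = Cᵀ) :
    frobNormSq (dev3 ((Fp⁻¹)ᵀ * C * Fp⁻¹)) =
      (((Fpᵀ * Fp)⁻¹ * C) * ((Fpᵀ * Fp)⁻¹ * C)).trace
        - (1 / 3 : ℝ) * (((Fpᵀ * Fp)⁻¹ * C).trace) ^ 2 := by
  have hX : ((Fp⁻¹)ᵀ * C * Fp⁻¹).IsSymm := by
    simp only [IsSymm, transpose_mul, transpose_transpose, ← hC, Matrix.mul_assoc]
  rw [frobNormSq_dev3_of_isSymm hX, Matrix.mul_inv_rev, ← transpose_nonsing_inv]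
  set P := (Fp⁻¹)ᵀ
  set Q := Fp⁻¹
  have hsq : (P * C * Q * (P * C * Q)).trace = (Q * P * C * (Q * P * C)).trace := by
    rw [← Matrix.mul_assoc, Matrix.trace_mul_comm]
    simp only [Matrix.mul_assoc]
  have htr : (P * C * Q).trace = (Q * P * C).trace := by
    rw [Matrix.trace_mul_comm, Matrix.mul_assoc]
  rw [hsq, htr]
end
end

section
/- Let F_e and F_p be invertible real 3×3 matrices, F = F_e F_p, B_e = F_e F_eᵀ, and let τ_e be a symmetric real 3×3 matrix commuting with B_e (τ_e B_e = B_e τ_e). Set Σ_e = F_eᵀ τ_e F_e⁻ᵀ. Then F⁻¹ [(dev₃ τ_e)·B_e] F⁻ᵀ = F_p⁻¹ (dev₃ Σ_e) F_p⁻ᵀ. -/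
open Matrix

noncomputable section

/-- Conjugation by `A` commutes with the deviatoric part. -/
theorem dev3_inv_mul_mul (A X : M3) (hA : IsUnit A.det) :
    dev3 (A⁻¹ * X * A) = A⁻¹ * dev3 X * A := by
  have htr : (A⁻¹ * X * A).trace = X.trace := by
    rw [Matrix.trace_mul_comm, ← Matrix.mul_assoc, Matrix.mul_nonsing_inv A hA, Matrix.one_mul]
  simp only [dev3, htr, Matrix.mul_sub, Matrix.sub_mul, Matrix.mul_smul, Matrix.smul_mul,
    Matrix.mul_one, Matrix.nonsing_inv_mul A hA]

/-- If `X` commutes with `A Aᵀ`, its conjugates by `A⁻¹` and by `Aᵀ` agree. -/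
theorem transpose_mul_mul_inv_transpose (A X : M3) (hA : IsUnit A.det)
    (hcomm : X * (A * Aᵀ) = (A * Aᵀ) * X) :
    Aᵀ * X * (A⁻¹)ᵀ = A⁻¹ * X * A := by
  have hT : Aᵀ * (A⁻¹)ᵀ = 1 := by
    rw [← Matrix.transpose_mul, Matrix.nonsing_inv_mul A hA, Matrix.transpose_one]
  calc Aᵀ * X * (A⁻¹)ᵀ = A⁻¹ * A * (Aᵀ * X * (A⁻¹)ᵀ) := by
        rw [Matrix.nonsing_inv_mul A hA, Matrix.one_mul]
    _ = A⁻¹ * ((A * Aᵀ) * X) * (A⁻¹)ᵀ := by simp only [Matrix.mul_assoc]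
    _ = A⁻¹ * X * A * (Aᵀ * (A⁻¹)ᵀ) := by rw [← hcomm]; simp only [Matrix.mul_assoc]
    _ = A⁻¹ * X * A := by rw [hT, Matrix.mul_one]

/-- Let `Fe`, `Fp` be invertible, `F = Fe Fp`, `Be = Fe Feᵀ`, and `τe` symmetric
commuting with `Be`; set `Se = Feᵀ τe Fe⁻ᵀ` (the Mandel stress Σ_e). Then
F⁻¹ [(dev₃ τe) Be] F⁻ᵀ = Fp⁻¹ (dev₃ Se) Fp⁻ᵀ. -/
theorem stmt13 (Fe Fp τe : M3) (hFe : IsUnit Fe.det) (hFp : IsUnit Fp.det)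
    (hτ : τe = τeᵀ) (hcomm : τe * (Fe * Feᵀ) = (Fe * Feᵀ) * τe) :
    (Fe * Fp)⁻¹ * (dev3 τe * (Fe * Feᵀ)) * ((Fe * Fp)⁻¹)ᵀ =
      Fp⁻¹ * dev3 (Feᵀ * τe * (Fe⁻¹)ᵀ) * (Fp⁻¹)ᵀ := by
  have hT : Feᵀ * (Fe⁻¹)ᵀ = 1 := by
    rw [← Matrix.transpose_mul, Matrix.nonsing_inv_mul Fe hFe, Matrix.transpose_one]
  rw [transpose_mul_mul_inv_transpose Fe τe hFe hcomm, dev3_inv_mul_mul Fe τe hFe,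
    Matrix.mul_inv_rev, Matrix.transpose_mul]
  calc Fp⁻¹ * Fe⁻¹ * (dev3 τe * (Fe * Feᵀ)) * ((Fe⁻¹)ᵀ * (Fp⁻¹)ᵀ)
      = Fp⁻¹ * (Fe⁻¹ * dev3 τe * Fe) * (Feᵀ * (Fe⁻¹)ᵀ) * (Fp⁻¹)ᵀ := by
        simp only [Matrix.mul_assoc]
    _ = Fp⁻¹ * (Fe⁻¹ * dev3 τe * Fe) * (Fp⁻¹)ᵀ := by rw [hT, Matrix.mul_one]
end
end
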